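/- Let f_{s1}, f_{s2}, g_{s1}, g_{s2}, h_s (s=1,2) and κ1, κ2 be as in the context, with (κ1,κ2) ≠ (0,0). For s = 1,2 let φ_{s,1}, …, φ_{s,n_s} : ℝ → ℝ be twice continuously differentiable and linearly independent over ℝ. Suppose K_{s,i} : ℝ^{n_1} × ℝ^{n_2} → ℝ (s = 1,2, 1 ≤ i ≤ n_s) are functions such that for every c = (c_{1,1},…,c_{1,n_1},c_{2,1},…,c_{2,n_2}) one has F_s(Σ_{i=1}^{n_1} c_{1,i}·φ_{1,i}, Σ_{i=1}^{n_2} c_{2,i}·φ_{2,i})(z) = Σ_{i=1}^{n_s} K_{s,i}(c)·φ_{s,i}(z) for all z ∈ ℝ. Let k_{s,i} : ℝ → ℝ be twice differentiable and set u_s(x1,x2,t) = Σ_{i=1}^{n_s} k_{s,i}(t)·φ_{s,i}(κ1·x1 + κ2·x2). Then ∂²u_s/∂t²(x1,x2,t) = H_s(u1(·,·,t), u2(·,·,t))(x1,x2) holds for all (x1,x2,t) ∈ ℝ³ and s = 1,2 if and only if k_{s,i}''(t) = K_{s,i}(k_{1,1}(t),…,k_{1,n_1}(t),k_{2,1}(t),…,k_{2,n_2}(t))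 for all t ∈ ℝ, s = 1,2 and 1 ≤ i ≤ n_s. -/

import Mathlib

/-- First-variable partial derivative of a function of two real variables. -/
noncomputable def pd1 (u : ℝ × ℝ → ℝ) (p : ℝ × ℝ) : ℝ :=
  deriv (fun x => u (x, p.2)) p.1

/-- Second-variable partial derivative of a function of two real variables. -/
noncomputable def pd2 (u : ℝ × ℝ → ℝ) (p : ℝ × ℝ) : ℝ :=
  deriv (fun y => u (p.1, y)) p.2

/-- The (2+1)-dimensional reaction–diffusion operator
`H(u1,u2) = ∂/∂x1(f1(u1,u2)·∂u1/∂x1 + f2(u1,u2)·∂u2/∂x1)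
          + ∂/∂x2(g1(u1,u2)·∂u1/∂x2 + g2(u1,u2)·∂u2/∂x2) + h(u1,u2)`. -/
noncomputable def Hop (f1 f2 g1 g2 h : ℝ × ℝ → ℝ) (u1 u2 : ℝ × ℝ → ℝ) (p : ℝ × ℝ) : ℝ :=
  deriv (fun x => f1 (u1 (x, p.2), u2 (x, p.2)) * pd1 u1 (x, p.2)
        + f2 (u1 (x, p.2), u2 (x, p.2)) * pd1 u2 (x, p.2)) p.1
  + deriv (fun y => g1 (u1 (p.1, y), u2 (p.1, y)) * pd2 u1 (p.1, y)
        + g2 (u1 (p.1, y), u2 (p.1, y)) * pd2 u2 (p.1, y)) p.2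
  + h (u1 p, u2 p)

/-- The reduced (1+1)-dimensional operator
`F(v1,v2)(z) = d/dz[(κ1²f1+κ2²g1)(v1,v2)·v1' + (κ1²f2+κ2²g2)(v1,v2)·v2'] + h(v1,v2)`. -/
noncomputable def Fop (κ1 κ2 : ℝ) (f1 f2 g1 g2 h : ℝ × ℝ → ℝ) (v1 v2 : ℝ → ℝ) (z : ℝ) : ℝ :=
  deriv (fun w => (κ1 ^ 2 * f1 (v1 w, v2 w) + κ2 ^ 2 * g1 (v1 w, v2 w)) * deriv v1 w
        + (κ1 ^ 2 * f2 (v1 w, v2 w) + κ2 ^ 2 * g2 (v1 w, v2 w)) * deriv v2 w) z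
  + h (v1 z, v2 z)

/-- Chain rule for the composition with an affine function. -/
lemma deriv_comp_affine (G : ℝ → ℝ) (hG : Differentiable ℝ G) (a b x : ℝ) :
    deriv (fun x => G (a * x + b)) x = a * deriv G (a * x + b) := by
  have h₁ : HasDerivAt (fun x => a * x + b) a x := by
    simpa using ((hasDerivAt_id x).const_mul a).add_const b
  rw [mul_comm]
  exact ((hG _).hasDerivAt.comp x h₁).deriv

/-- On plane waves with phase `κ1·x1 + κ2·x2` the two-dimensional operator reduces to the
one-dimensional one. -/
lemma Hop_planeWave (κ1 κ2 : ℝ) {f1 f2 g1 g2 : ℝ × ℝ → ℝ} (h : ℝ × ℝ → ℝ)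
    (hf1 : Differentiable ℝ f1) (hf2 : Differentiable ℝ f2)
    (hg1 : Differentiable ℝ g1) (hg2 : Differentiable ℝ g2)
    {v1 v2 : ℝ → ℝ} (hv1 : ContDiff ℝ 2 v1) (hv2 : ContDiff ℝ 2 v2) (x1 x2 : ℝ) :
    Hop f1 f2 g1 g2 h (fun p => v1 (κ1 * p.1 + κ2 * p.2)) (fun p => v2 (κ1 * p.1 + κ2 * p.2))
      (x1, x2) = Fop κ1 κ2 f1 f2 g1 g2 h v1 v2 (κ1 * x1 + κ2 * x2) := by
  have d1 : Differentiable ℝ v1 := hv1.differentiable (by norm_num)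
  have d2 : Differentiable ℝ v2 := hv2.differentiable (by norm_num)
  have dd1 : Differentiable ℝ (deriv v1) :=
    ((contDiff_succ_iff_deriv (n := 1)).1 hv1).2.2.differentiable (by norm_num)
  have dd2 : Differentiable ℝ (deriv v2) :=
    ((contDiff_succ_iff_deriv (n := 1)).1 hv2).2.2.differentiable (by norm_num)
  have hflux : ∀ {a b : ℝ × ℝ → ℝ}, Differentiable ℝ a → Differentiable ℝ b →
      Differentiable ℝ (fun w => a (v1 w, v2 w) * deriv v1 w + b (v1 w, v2 w) * deriv v2 w) := by
    intro a b ha hb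
    exact ((ha.comp (d1.prodMk d2)).mul dd1).add ((hb.comp (d1.prodMk d2)).mul dd2)
  have hF := hflux hf1 hf2
  have hG := hflux hg1 hg2
  have hpd1 : ∀ {v : ℝ → ℝ}, Differentiable ℝ v → ∀ x,
      pd1 (fun p => v (κ1 * p.1 + κ2 * p.2)) (x, x2) = κ1 * deriv v (κ1 * x + κ2 * x2) :=
    fun hv x => deriv_comp_affine _ hv κ1 (κ2 * x2) x
  have hpd2 : ∀ {v : ℝ → ℝ}, Differentiable ℝ v → ∀ y,
      pd2 (fun p => v (κ1 * p.1 + κ2 * p.2)) (x1, y) = κ2 * deriv v (κ1 * x1 + κ2 * y) := by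
    intro v hv y
    have := deriv_comp_affine _ hv κ2 (κ1 * x1) y
    simpa only [pd2, add_comm] using this
  have e1 : deriv (fun x =>
      f1 (v1 (κ1 * x + κ2 * x2), v2 (κ1 * x + κ2 * x2)) * (κ1 * deriv v1 (κ1 * x + κ2 * x2))
      + f2 (v1 (κ1 * x + κ2 * x2), v2 (κ1 * x + κ2 * x2)) * (κ1 * deriv v2 (κ1 * x + κ2 * x2))) x1
      = κ1 ^ 2 * deriv (fun w => f1 (v1 w, v2 w) * deriv v1 w + f2 (v1 w, v2 w) * deriv v2 w)
          (κ1 * x1 + κ2 * x2) := by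
    have := deriv_comp_affine _ (hF.const_mul κ1) κ1 (κ2 * x2) x1
    rw [deriv_const_mul _ (hF _)] at this
    rw [pow_two, mul_assoc, ← this]
    congr 1
    ext x
    ring
  have e2 : deriv (fun y =>
      g1 (v1 (κ1 * x1 + κ2 * y), v2 (κ1 * x1 + κ2 * y)) * (κ2 * deriv v1 (κ1 * x1 + κ2 * y))
      + g2 (v1 (κ1 * x1 + κ2 * y), v2 (κ1 * x1 + κ2 * y)) * (κ2 * deriv v2 (κ1 * x1 + κ2 * y))) x2
      = κ2 ^ 2 * deriv (fun w => g1 (v1 w, v2 w) * deriv v1 w + g2 (v1 w, v2 w) * deriv v2 w)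
          (κ1 * x1 + κ2 * x2) := by
    have := deriv_comp_affine _ (hG.const_mul κ2) κ2 (κ1 * x1) x2
    rw [deriv_const_mul _ (hG _), add_comm (κ2 * x2)] at this
    rw [pow_two, mul_assoc, ← this]
    congr 1
    ext y
    rw [add_comm (κ2 * y)]
    ring
  have e3 : deriv (fun w =>
      (κ1 ^ 2 * f1 (v1 w, v2 w) + κ2 ^ 2 * g1 (v1 w, v2 w)) * deriv v1 w
      + (κ1 ^ 2 * f2 (v1 w, v2 w) + κ2 ^ 2 * g2 (v1 w, v2 w)) * deriv v2 w) (κ1 * x1 + κ2 * x2)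
      = κ1 ^ 2 * deriv (fun w => f1 (v1 w, v2 w) * deriv v1 w + f2 (v1 w, v2 w) * deriv v2 w)
          (κ1 * x1 + κ2 * x2)
        + κ2 ^ 2 * deriv (fun w => g1 (v1 w, v2 w) * deriv v1 w + g2 (v1 w, v2 w) * deriv v2 w)
          (κ1 * x1 + κ2 * x2) := by
    rw [← deriv_const_mul _ (hF _), ← deriv_const_mul _ (hG _),
      ← deriv_fun_add ((hF _).const_mul _) ((hG _).const_mul _)]
    congr 1
    ext w
    ring
  simp only [Hop, Fop, hpd1 d1, hpd1 d2, hpd2 d1, hpd2 d2]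
  rw [e1, e2, e3]

/-- Second derivative of a linear combination with constant weights. -/
lemma deriv_deriv_sum_mul_const {ι : Type*} [Fintype ι] {k : ι → ℝ → ℝ}
    (hk : ∀ i, Differentiable ℝ (k i)) (hk2 : ∀ i, Differentiable ℝ (deriv (k i)))
    (a : ι → ℝ) (t : ℝ) :
    deriv (deriv (fun τ => ∑ i, k i τ * a i)) t = ∑ i, deriv (deriv (k i)) t * a i := by
  have h₁ : deriv (fun τ => ∑ i, k i τ * a i) = fun τ => ∑ i, deriv (k i) τ * a i := by
    ext τ
    exact (HasDerivAt.fun_sum fun i _ => (hk i τ).hasDerivAt.mul_const (a i)).deriv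
  rw [h₁]
  exact (HasDerivAt.fun_sum fun i _ => (hk2 i t).hasDerivAt.mul_const (a i)).deriv

/-- A nonzero linear form on the plane takes every real value. -/
lemma exists_linear_form_eq {κ1 κ2 : ℝ} (hκ : (κ1, κ2) ≠ (0, 0)) (z : ℝ) :
    ∃ x1 x2 : ℝ, κ1 * x1 + κ2 * x2 = z := by
  by_cases h₁ : κ1 = 0
  · have h₂ : κ2 ≠ 0 := fun h₂ => hκ (by rw [h₁, h₂])
    exact ⟨0, z / κ2, by field_simp; ring⟩
  · exact ⟨z / κ1, 0, by field_simp; ring⟩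

/-- with an invariant linear product space spanned by the `φ_{s,i}` and
expansion coefficients `K_{s,i}`, the generalized separable function
`u_s = Σ_i k_{s,i}(t)·φ_{s,i}(κ1·x1+κ2·x2)` solves the second-order-in-time system
`∂²u_s/∂t² = H_s(u1,u2)` iff the coefficients solve `k_{s,i}'' = K_{s,i}(k)`. -/
theorem stmt5 (κ1 κ2 : ℝ) (hκ : (κ1, κ2) ≠ (0, 0))
    (f g : Fin 2 → Fin 2 → ℝ × ℝ → ℝ) (h : Fin 2 → ℝ × ℝ → ℝ)
    (hf : ∀ s i, ContDiff ℝ 1 (f s i)) (hg : ∀ s i, ContDiff ℝ 1 (g s i))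
    (hh : ∀ s, Continuous (h s))
    (n : Fin 2 → ℕ) (φ : (s : Fin 2) → Fin (n s) → ℝ → ℝ)
    (hφ : ∀ s i, ContDiff ℝ 2 (φ s i))
    (hind : ∀ s, LinearIndependent ℝ (φ s))
    (K : (s : Fin 2) → Fin (n s) → ((s : Fin 2) → Fin (n s) → ℝ) → ℝ)
    (hK : ∀ c : (s : Fin 2) → Fin (n s) → ℝ, ∀ s : Fin 2, ∀ z : ℝ,
      Fop κ1 κ2 (f s 0) (f s 1) (g s 0) (g s 1) (h s)
        (fun w => ∑ i, c 0 i * φ 0 i w) (fun w => ∑ i, c 1 i * φ 1 i w) z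
      = ∑ i, K s i c * φ s i z)
    (k : (s : Fin 2) → Fin (n s) → ℝ → ℝ)
    (hk : ∀ s i, Differentiable ℝ (k s i))
    (hk2 : ∀ s i, Differentiable ℝ (deriv (k s i))) :
    (∀ s : Fin 2, ∀ x1 x2 t : ℝ,
        deriv (deriv (fun τ => ∑ i, k s i τ * φ s i (κ1 * x1 + κ2 * x2))) t
        = Hop (f s 0) (f s 1) (g s 0) (g s 1) (h s)
            (fun p => ∑ i, k 0 i t * φ 0 i (κ1 * p.1 + κ2 * p.2))
            (fun p => ∑ i, k 1 i t * φ 1 i (κ1 * p.1 + κ2 * p.2)) (x1, x2))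
    ↔
    (∀ s : Fin 2, ∀ i : Fin (n s), ∀ t : ℝ,
        deriv (deriv (k s i)) t = K s i (fun s' i' => k s' i' t)) := by
  have hv : ∀ s t, ContDiff ℝ 2 (fun w => ∑ i, k s i t * φ s i w) := fun s t =>
    ContDiff.sum fun i _ => contDiff_const.mul (hφ s i)
  have hH : ∀ (s : Fin 2) (x1 x2 t : ℝ),
      Hop (f s 0) (f s 1) (g s 0) (g s 1) (h s)
        (fun p => ∑ i, k 0 i t * φ 0 i (κ1 * p.1 + κ2 * p.2))
        (fun p => ∑ i, k 1 i t * φ 1 i (κ1 * p.1 + κ2 * p.2)) (x1, x2)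
      = ∑ i, K s i (fun s' i' => k s' i' t) * φ s i (κ1 * x1 + κ2 * x2) := by
    intro s x1 x2 t
    rw [← hK (fun s' i' => k s' i' t)]
    exact Hop_planeWave κ1 κ2 (h s) ((hf s 0).differentiable one_ne_zero)
      ((hf s 1).differentiable one_ne_zero) ((hg s 0).differentiable one_ne_zero)
      ((hg s 1).differentiable one_ne_zero) (hv 0 t) (hv 1 t) x1 x2
  simp only [hH, deriv_deriv_sum_mul_const (hk _) (hk2 _)]
  constructor
  · intro hpde s i t
    refine sub_eq_zero.1 (Fintype.linearIndependent_iff.1 (hind s)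
      (fun i => deriv (deriv (k s i)) t - K s i (fun s' i' => k s' i' t)) ?_ i)
    ext z
    obtain ⟨x1, x2, rfl⟩ := exists_linear_form_eq hκ z
    simp [sub_mul, Finset.sum_sub_distrib, hpde s x1 x2 t]
  · intro hode s x1 x2 t
    simp only [hode]
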